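/- Let r ≥ 3 and t ≥ r+2. Let G be a left-compressed r-uniform hypergraph on t vertices satisfying |[t−2]^{(r−1)} \ E_t| ≥ 2^{r−3}|E_{(t−1)t}|. Then: (a) if G contains the complete r-graph [t−1]^{(r)}, then λ(G) = λ([t−1]^{(r)}); (b) if G does not contain [t−1]^{(r)}, then λ(G) < λ([t−1]^{(r)}). -/

import Mathlib

open Finset

/-- The polynomial λ(G, w) = Σ_{e ∈ E} Π_{i ∈ e} w i. -/
def lagPoly (E : Finset (Finset ℕ)) (w : ℕ → ℝ) : ℝ :=
  ∑ e ∈ E, ∏ i ∈ e, w i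

/-- A feasible weighting on vertex set [n] = {0, …, n-1}. -/
def IsWeighting (n : ℕ) (w : ℕ → ℝ) : Prop :=
  (∀ i, 0 ≤ w i) ∧ (∀ i, n ≤ i → w i = 0) ∧ ∑ i ∈ Finset.range n, w i = 1

/-- The Lagrangian of a hypergraph with edge set `E`. -/
noncomputable def lag (E : Finset (Finset ℕ)) : ℝ :=
  sSup {x | ∃ n w, IsWeighting n w ∧ x = lagPoly E w}

/-- The complete r-uniform hypergraph on vertex set {0, …, t-1}. -/
def completeG (t r : ℕ) : Finset (Finset ℕ) :=
  (Finset.range t).powersetCard r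

/-- A hypergraph is left-compressed if replacing any vertex of an edge by a
smaller vertex (not already in the edge) again yields an edge. -/
def LeftCompressed (E : Finset (Finset ℕ)) : Prop :=
  ∀ e ∈ E, ∀ j ∈ e, ∀ i < j, i ∉ e → insert i (e.erase j) ∈ E

/-- Moving weight `ε` from `j` to `i`. -/
def mv (x : ℕ → ℝ) (i j : ℕ) (ε : ℝ) : ℕ → ℝ :=
  fun k => x k + (if k = i then ε else 0) - (if k = j then ε else 0)

def lkU (E : Finset (Finset ℕ)) (i j : ℕ) (x : ℕ → ℝ) : ℝ :=
  ∑ e ∈ E.filter (fun e => i ∈ e ∧ j ∉ e), ∏ k ∈ e.erase i, x k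

def lkW (E : Finset (Finset ℕ)) (i j : ℕ) (x : ℕ → ℝ) : ℝ :=
  ∑ e ∈ E.filter (fun e => i ∈ e ∧ j ∈ e), ∏ k ∈ (e.erase i).erase j, x k

def lkP (E : Finset (Finset ℕ)) (i j : ℕ) (x : ℕ → ℝ) : ℝ :=
  ∑ e ∈ E.filter (fun e => i ∉ e ∧ j ∉ e), ∏ k ∈ e, x k

theorem lag_decomp (E : Finset (Finset ℕ)) (i j : ℕ) (hij : i ≠ j) (x : ℕ → ℝ) :
    lagPoly E x = lkP E i j x + x i * lkU E i j x + x j * lkU E j i x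
      + x i * x j * lkW E i j x := by
  unfold lagPoly lkP lkU lkW
  simp only [Finset.sum_filter, Finset.mul_sum, ← Finset.sum_add_distrib]
  apply Finset.sum_congr rfl
  intro e _
  by_cases hi : i ∈ e <;> by_cases hj : j ∈ e <;> simp [hi, hj]
  · have hj' : j ∈ e.erase i := Finset.mem_erase.2 ⟨hij.symm, hj⟩
    rw [← Finset.mul_prod_erase e x hi, ← Finset.mul_prod_erase _ x hj']
    ring
  · rw [← Finset.mul_prod_erase e x hi]
  · rw [← Finset.mul_prod_erase e x hj]

theorem lkU_congr (E : Finset (Finset ℕ)) (i j : ℕ) (x y : ℕ → ℝ)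
    (h : ∀ k, k ≠ i → k ≠ j → x k = y k) : lkU E i j x = lkU E i j y := by
  unfold lkU
  apply Finset.sum_congr rfl
  intro e he
  apply Finset.prod_congr rfl
  intro k hk
  simp only [Finset.mem_filter, Finset.mem_erase] at he hk
  exact h k hk.1 (fun h' => he.2.2 (h' ▸ hk.2))

theorem lkW_congr (E : Finset (Finset ℕ)) (i j : ℕ) (x y : ℕ → ℝ)
    (h : ∀ k, k ≠ i → k ≠ j → x k = y k) : lkW E i j x = lkW E i j y := by
  unfold lkW
  apply Finset.sum_congr rfl
  intro e he
  apply Finset.prod_congr rfl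
  intro k hk
  simp only [Finset.mem_erase] at hk
  exact h k hk.2.1 hk.1

theorem lkP_congr (E : Finset (Finset ℕ)) (i j : ℕ) (x y : ℕ → ℝ)
    (h : ∀ k, k ≠ i → k ≠ j → x k = y k) : lkP E i j x = lkP E i j y := by
  unfold lkP
  apply Finset.sum_congr rfl
  intro e he
  apply Finset.prod_congr rfl
  intro k hk
  simp only [Finset.mem_filter] at he
  exact h k (fun h' => he.2.1 (h' ▸ hk)) (fun h' => he.2.2 (h' ▸ hk))

theorem lag_mv (E : Finset (Finset ℕ)) (i j : ℕ) (hij : i ≠ j) (x : ℕ → ℝ) (ε : ℝ) :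
    lagPoly E (mv x i j ε) = lagPoly E x + ε * (lkU E i j x - lkU E j i x)
      + lkW E i j x * (ε * (x j - x i) - ε ^ 2) := by
  have h : ∀ k, k ≠ i → k ≠ j → mv x i j ε k = x k := by
    intro k h1 h2; simp [mv, h1, h2]
  rw [lag_decomp E i j hij, lag_decomp E i j hij x, lkP_congr E i j _ x h,
    lkU_congr E i j _ x h, lkU_congr E j i _ x (fun k a b => h k b a), lkW_congr E i j _ x h]
  have h1 : mv x i j ε i = x i + ε := by simp [mv, hij]
  have h2 : mv x i j ε j = x j - ε := by simp [mv, hij.symm]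
  rw [h1, h2]; ring

theorem mv_weighting (t : ℕ) (x : ℕ → ℝ) (hx : IsWeighting t x) (i j : ℕ) (hij : i ≠ j)
    (hi : i < t) (hj : j < t) (ε : ℝ) (h1 : 0 ≤ x i + ε) (h2 : 0 ≤ x j - ε) :
    IsWeighting t (mv x i j ε) := by
  obtain ⟨ha, hb, hc⟩ := hx
  refine ⟨?_, ?_, ?_⟩
  · intro k
    by_cases hki : k = i
    · subst hki; simpa [mv, hij] using h1
    · by_cases hkj : k = j
      · subst hkj; simpa [mv, hki] using h2
      · simpa [mv, hki, hkj] using ha k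
  · intro k hk
    have e1 : k ≠ i := by omega
    have e2 : k ≠ j := by omega
    simpa [mv, e1, e2] using hb k hk
  · simp [mv, Finset.sum_add_distrib, Finset.sum_sub_distrib, hi, hj, hc]

theorem mv_moment (t : ℕ) (x : ℕ → ℝ) (i j : ℕ)
    (hi : i < t) (hj : j < t) (ε : ℝ) :
    ∑ k ∈ range t, (k : ℝ) * mv x i j ε k = ∑ k ∈ range t, (k : ℝ) * x k + ε * (i - j) := by
  simp [mv, mul_add, mul_sub, Finset.sum_add_distrib, Finset.sum_sub_distrib, hi, hj]
  ring

theorem sum_le_of_inj {α β : Type*} [DecidableEq β] (S : Finset α) (T : Finset β) (φ : α → β)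
    (f : α → ℝ) (g : β → ℝ) (hφ : ∀ s ∈ S, φ s ∈ T)
    (hinj : ∀ s ∈ S, ∀ s' ∈ S, φ s = φ s' → s = s')
    (hfg : ∀ s ∈ S, f s ≤ g (φ s)) (hg : ∀ b ∈ T, 0 ≤ g b) :
    ∑ s ∈ S, f s ≤ ∑ b ∈ T, g b := by
  calc ∑ s ∈ S, f s ≤ ∑ s ∈ S, g (φ s) := Finset.sum_le_sum hfg
    _ = ∑ b ∈ S.image φ, g b := by
        rw [Finset.sum_image]
        intro a ha b hb h
        exact hinj a ha b hb h
    _ ≤ ∑ b ∈ T, g b := by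
        apply Finset.sum_le_sum_of_subset_of_nonneg
        · intro b hb
          obtain ⟨a, ha, rfl⟩ := Finset.mem_image.1 hb
          exact hφ a ha
        · intro b hb _; exact hg b hb

theorem lagPoly_mono (E F : Finset (Finset ℕ)) (h : E ⊆ F) (x : ℕ → ℝ) (hx : ∀ i, 0 ≤ x i) :
    lagPoly E x ≤ lagPoly F x :=
  Finset.sum_le_sum_of_subset_of_nonneg h (fun _ _ _ => Finset.prod_nonneg (fun i _ => hx i))

/-- swapping closure between i and j compares the links -/
theorem lkU_le (E : Finset (Finset ℕ)) (i j : ℕ) (hij : i ≠ j) (x : ℕ → ℝ) (hx : ∀ i, 0 ≤ x i)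
    (h : ∀ e ∈ E, j ∈ e → i ∉ e → insert i (e.erase j) ∈ E) :
    lkU E j i x ≤ lkU E i j x := by
  unfold lkU
  apply sum_le_of_inj _ _ (fun e => insert i (e.erase j))
  · intro e he
    simp only [Finset.mem_filter] at he ⊢
    refine ⟨h e he.1 he.2.1 he.2.2, by simp, by simp [hij.symm]⟩
  · intro e he e' he' hee
    simp only [Finset.mem_filter] at he he'
    ext k
    have := Finset.ext_iff.1 hee k
    simp only [Finset.mem_insert, Finset.mem_erase] at this
    by_cases h1 : k = j
    · subst h1; simp [he.2.1, he'.2.1]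
    · by_cases h2 : k = i
      · subst h2; simp [he.2.2, he'.2.2]
      · simpa [h1, h2] using this
  · intro e he
    simp only [Finset.mem_filter] at he
    rw [Finset.erase_insert]
    simp [he.2.2]
  · intro e _
    exact Finset.prod_nonneg (fun i _ => hx i)

theorem lkW_nonneg (E : Finset (Finset ℕ)) (i j : ℕ) (x : ℕ → ℝ) (hx : ∀ i, 0 ≤ x i) :
    0 ≤ lkW E i j x :=
  Finset.sum_nonneg (fun _ _ => Finset.prod_nonneg (fun i _ => hx i))

/-- First-order condition. -/
theorem first_order (t : ℕ) (E : Finset (Finset ℕ)) (x : ℕ → ℝ) (hx : IsWeighting t x)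
    (hopt : ∀ w, IsWeighting t w → lagPoly E w ≤ lagPoly E x)
    (i j : ℕ) (hij : i ≠ j) (hi : i < t) (hj : j < t) (hpos : 0 < x j) :
    lkU E i j x - lkU E j i x ≤ lkW E i j x * (x i - x j) := by
  by_contra hcon
  push Not at hcon
  set D := lkU E i j x - lkU E j i x - lkW E i j x * (x i - x j) with hD
  have hDpos : 0 < D := by rw [hD]; linarith
  have hW := lkW_nonneg E i j x hx.1
  set W := lkW E i j x with hWdef
  set ε := min (x j) (D / (W + 1)) with hε
  have hεpos : 0 < ε := lt_min hpos (by positivity)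
  have hε1 : ε ≤ x j := min_le_left _ _
  have hε2 : ε * (W + 1) ≤ D := by
    rw [← le_div_iff₀ (by positivity)]; exact min_le_right _ _
  have := hopt _ (mv_weighting t x hx i j hij hi hj ε (by have := hx.1 i; linarith) (by linarith))
  rw [lag_mv E i j hij x ε] at this
  have h3 : ε * (D - W * ε) ≤ 0 := by
    have : ε * (D - W * ε) = ε * (lkU E i j x - lkU E j i x) + W * (ε * (x j - x i) - ε ^ 2) := by
      rw [hD]; ring
    linarith
  nlinarith

theorem lagPoly_continuous (E : Finset (Finset ℕ)) : Continuous (lagPoly E) := by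
  unfold lagPoly
  fun_prop

theorem weighting_compact (t : ℕ) : IsCompact {w : ℕ → ℝ | IsWeighting t w} := by
  apply IsCompact.of_isClosed_subset
    (isCompact_univ_pi (fun _ : ℕ => (isCompact_Icc : IsCompact (Set.Icc (0 : ℝ) 1))))
  · have : {w : ℕ → ℝ | IsWeighting t w} =
      (⋂ i, {w : ℕ → ℝ | 0 ≤ w i}) ∩ ((⋂ i, ⋂ (_ : t ≤ i), {w : ℕ → ℝ | w i = 0}) ∩
        {w : ℕ → ℝ | ∑ i ∈ Finset.range t, w i = 1}) := by
      ext w; simp [IsWeighting]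
    rw [this]
    refine IsClosed.inter ?_ (IsClosed.inter ?_ ?_)
    · exact isClosed_iInter (fun i => isClosed_le (by fun_prop) (by fun_prop))
    · exact isClosed_iInter (fun i => isClosed_iInter (fun _ =>
        isClosed_eq (by fun_prop) (by fun_prop)))
    · exact isClosed_eq (by fun_prop) (by fun_prop)
  · intro w hw i _
    obtain ⟨h1, h2, h3⟩ := hw
    refine ⟨h1 i, ?_⟩
    by_cases hi : i < t
    · rw [← h3]
      exact Finset.single_le_sum (fun k _ => h1 k) (Finset.mem_range.2 hi)
    · rw [h2 i (by omega)]; norm_num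

theorem reduce_weighting (t r : ℕ) (ht : 0 < t) (E : Finset (Finset ℕ))
    (hE : E ⊆ (Finset.range t).powersetCard r) (n : ℕ) (w : ℕ → ℝ) (hw : IsWeighting n w) :
    ∃ w', IsWeighting t w' ∧ lagPoly E w ≤ lagPoly E w' := by
  obtain ⟨h1, h2, h3⟩ := hw
  have hle : ∑ i ∈ range t, w i ≤ 1 := by
    have e1 : ∑ i ∈ range (max n t), w i = ∑ i ∈ range n, w i := by
      symm
      apply Finset.sum_subset (Finset.range_mono (le_max_left _ _))
      intro k _ hk
      exact h2 k (by simpa using hk)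
    rw [← h3, ← e1]
    exact Finset.sum_le_sum_of_subset_of_nonneg (Finset.range_mono (le_max_right _ _))
      (fun k _ _ => h1 k)
  set d := 1 - ∑ i ∈ range t, w i with hd
  have hd0 : 0 ≤ d := by linarith
  refine ⟨fun k => if k < t then w k + (if k = 0 then d else 0) else 0, ⟨?_, ?_, ?_⟩, ?_⟩
  · intro k
    have := h1 k
    dsimp only
    split_ifs <;> linarith
  · intro k hk
    simp [not_lt.2 hk]
  · have : ∑ k ∈ range t, (if k < t then w k + (if k = 0 then d else 0) else 0)
        = ∑ k ∈ range t, (w k + (if k = 0 then d else 0)) := by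
      apply Finset.sum_congr rfl
      intro k hk
      rw [if_pos (Finset.mem_range.1 hk)]
    rw [this, Finset.sum_add_distrib]
    simp [ht, hd]
  · apply Finset.sum_le_sum
    intro e he
    apply Finset.prod_le_prod
    · intro k _; exact h1 k
    · intro k hk
      have hkt : k < t := Finset.mem_range.1 ((Finset.mem_powersetCard.1 (hE he)).1 hk)
      rw [if_pos hkt]
      split_ifs <;> linarith

theorem exists_opt (t r : ℕ) (ht : 0 < t) (E : Finset (Finset ℕ))
    (hE : E ⊆ (Finset.range t).powersetCard r) :
    ∃ x, IsWeighting t x ∧ (∀ n w, IsWeighting n w → lagPoly E w ≤ lagPoly E x) ∧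
      lag E = lagPoly E x ∧
      (∀ y, IsWeighting t y → lagPoly E x ≤ lagPoly E y →
        ∑ k ∈ range t, (k : ℝ) * x k ≤ ∑ k ∈ range t, (k : ℝ) * y k) := by
  have hne : {w : ℕ → ℝ | IsWeighting t w}.Nonempty := by
    refine ⟨fun k => if k = 0 then 1 else 0, ?_, ?_, ?_⟩
    · intro k; dsimp only; split_ifs <;> norm_num
    · intro k hk; have : k ≠ 0 := by omega
      simp [this]
    · simp [ht]
  obtain ⟨z, hz, hzmax⟩ := (weighting_compact t).exists_isMaxOn hne (lagPoly_continuous E).continuousOn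
  have hzmax' : ∀ w, IsWeighting t w → lagPoly E w ≤ lagPoly E z := fun w hw => hzmax hw
  have hc2 : IsCompact ({w : ℕ → ℝ | IsWeighting t w} ∩ {w | lagPoly E z ≤ lagPoly E w}) :=
    (weighting_compact t).inter_right (isClosed_le continuous_const (lagPoly_continuous E))
  obtain ⟨x, hx, hxmin⟩ := hc2.exists_isMinOn ⟨z, hz, le_refl (lagPoly E z)⟩
    (f := fun w : ℕ → ℝ => ∑ k ∈ range t, (k : ℝ) * w k) (by fun_prop)
  have hxz : lagPoly E z ≤ lagPoly E x := hx.2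
  have hall : ∀ n w, IsWeighting n w → lagPoly E w ≤ lagPoly E x := by
    intro n w hw
    obtain ⟨w', hw', hle⟩ := reduce_weighting t r ht E hE n w hw
    exact hle.trans ((hzmax' w' hw').trans hxz)
  refine ⟨x, hx.1, hall, ?_, ?_⟩
  · apply IsGreatest.csSup_eq
    refine ⟨⟨t, x, hx.1, rfl⟩, ?_⟩
    rintro _ ⟨n, w, hw, rfl⟩
    exact hall n w hw
  · intro y hy hxy
    exact hxmin ⟨hy, hxz.trans hxy⟩

theorem le_lag (t r : ℕ) (ht : 0 < t) (E : Finset (Finset ℕ))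
    (hE : E ⊆ (Finset.range t).powersetCard r) (n : ℕ) (w : ℕ → ℝ) (hw : IsWeighting n w) :
    lagPoly E w ≤ lag E := by
  obtain ⟨x, _, h, h', _⟩ := exists_opt t r ht E hE
  rw [h']; exact h n w hw

theorem opt_antitone (t : ℕ) (E : Finset (Finset ℕ)) (hlc : LeftCompressed E)
    (x : ℕ → ℝ) (hx : IsWeighting t x)
    (hmin : ∀ y, IsWeighting t y → lagPoly E x ≤ lagPoly E y →
        ∑ k ∈ range t, (k : ℝ) * x k ≤ ∑ k ∈ range t, (k : ℝ) * y k)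
    (i j : ℕ) (hij : i < j) (hj : j < t) : x j ≤ x i := by
  by_contra hcon
  push Not at hcon
  have h1 := mv_weighting t x hx i j hij.ne (by omega) hj (x j - x i)
    (by have := hx.1 j; linarith) (by have := hx.1 i; linarith)
  have h2 := lag_mv E i j hij.ne x (x j - x i)
  have h3 := lkU_le E i j hij.ne x hx.1 (fun e he hje hie => hlc e he j hje i hij hie)
  have h4 := hmin _ h1 (by rw [h2]; nlinarith)
  rw [mv_moment t x i j (by omega) hj] at h4
  have h5 : (i : ℝ) < j := by exact_mod_cast hij
  nlinarith

theorem lc_union (E : Finset (Finset ℕ)) (hlc : LeftCompressed E) (m r : ℕ) :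
    LeftCompressed (E ∪ completeG m r) := by
  intro e he j hj i hij hi
  rcases Finset.mem_union.1 he with he | he
  · exact Finset.mem_union_left _ (hlc e he j hj i hij hi)
  · apply Finset.mem_union_right
    simp only [completeG, Finset.mem_powersetCard] at he ⊢
    refine ⟨?_, ?_⟩
    · intro k hk
      rcases Finset.mem_insert.1 hk with rfl | hk
      · have := Finset.mem_range.1 (he.1 hj)
        exact Finset.mem_range.2 (by omega)
      · exact he.1 (Finset.mem_of_mem_erase hk)
    · rw [Finset.card_insert_of_notMem (by simp [hi]), Finset.card_erase_add_one hj]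
      exact he.2

/-- Case (a) core: weight of last vertex vanishes. -/
theorem last_zero (r t : ℕ) (hr : 3 ≤ r) (ht : r + 2 ≤ t)
    (E : Finset (Finset ℕ)) (hE : E ⊆ (Finset.range t).powersetCard r)
    (hlc : LeftCompressed E) (hK : completeG (t - 1) r ⊆ E)
    (hcond : 2 ^ (r - 3) * (((Finset.range (t - 2)).powersetCard (r - 2)).filter
        (fun B => insert (t - 2) (insert (t - 1) B) ∈ E)).card ≤
      (((Finset.range (t - 2)).powersetCard (r - 1)).filter
        (fun A => insert (t - 1) A ∉ E)).card)
    (x : ℕ → ℝ) (hx : IsWeighting t x)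
    (hopt : ∀ w, IsWeighting t w → lagPoly E w ≤ lagPoly E x)
    (hmin : ∀ y, IsWeighting t y → lagPoly E x ≤ lagPoly E y →
        ∑ k ∈ range t, (k : ℝ) * x k ≤ ∑ k ∈ range t, (k : ℝ) * y k) :
    x (t - 1) = 0 := by
  by_contra hne
  obtain ⟨s, rfl⟩ : ∃ s, t = s + 2 := ⟨t - 2, by omega⟩
  have e1 : s + 2 - 1 = s + 1 := by omega
  have e2 : s + 2 - 2 = s := by omega
  rw [e1] at hne hK
  rw [e1, e2] at hcond
  have ha : 0 < x (s + 1) := lt_of_le_of_ne (hx.1 _) (Ne.symm hne)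
  have hanti := opt_antitone (s + 2) E hlc x hx hmin
  have hab : x (s + 1) ≤ x s := hanti s (s + 1) (by omega) (by omega)
  have hb : 0 < x s := by linarith
  have hpos : ∀ k < s + 2, 0 < x k := by
    intro k hk
    rcases Nat.lt_or_ge k (s + 1) with h | h
    · have := hanti k (s + 1) h (by omega); linarith
    · have : k = s + 1 := by omega
      rw [this]; exact ha
  have hprod : ∀ e : Finset ℕ, 0 ≤ ∏ k ∈ e, x k := fun e => Finset.prod_nonneg (fun i _ => hx.1 i)
  have hmem : ∀ e ∈ E, e ⊆ range (s + 2) ∧ e.card = r := fun e he => Finset.mem_powersetCard.1 (hE he)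
  have hKmem : ∀ e : Finset ℕ, e ⊆ range (s + 1) → e.card = r → e ∈ E := fun e h1 h2 =>
    hK (Finset.mem_powersetCard.2 ⟨h1, h2⟩)
  -- first: x 0 ≤ a + b
  have hW0 : 0 < lkW E 0 s x := by
    obtain ⟨e, h1, h2, h3⟩ := Finset.exists_subsuperset_card_eq
      (s := ({0, s} : Finset ℕ)) (t := range (s + 1)) (n := r)
      (by intro k hk; simp at hk ⊢; omega)
      (by have : ({0, s} : Finset ℕ).card ≤ 2 := Finset.card_le_two
          omega) (by simp; omega)
    unfold lkW
    apply Finset.sum_pos'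
    · intro e _; exact hprod _
    · refine ⟨e, ?_, ?_⟩
      · simp only [Finset.mem_filter]
        exact ⟨hKmem e h2 h3, h1 (by simp), h1 (by simp)⟩
      · apply Finset.prod_pos
        intro k hk
        have := Finset.mem_range.1 (h2 (Finset.mem_of_mem_erase (Finset.mem_of_mem_erase hk)))
        exact hpos k (by omega)
  have hU0 : lkU E 0 s x ≤ lkU E s 0 x + x (s + 1) * lkW E 0 s x := by
    have hs0 : s ≠ 0 := by omega
    unfold lkU lkW
    rw [← Finset.sum_filter_add_sum_filter_not _ (fun e => s + 1 ∉ e)]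
    apply add_le_add
    · apply sum_le_of_inj _ _ (fun e => insert s (e.erase 0))
      · intro e he
        simp only [Finset.mem_filter] at he ⊢
        obtain ⟨⟨h1, h2, h3⟩, h4⟩ := he
        have := hmem e h1
        refine ⟨hKmem _ ?_ ?_, by simp, by simp [hs0.symm]⟩
        · intro k hk
          rcases Finset.mem_insert.1 hk with rfl | hk
          · simp
          · have hk := Finset.mem_of_mem_erase hk
            have h5 := Finset.mem_range.1 (this.1 hk)
            have : k ≠ s + 1 := fun h => h4 (h ▸ hk)
            exact Finset.mem_range.2 (by omega)
        · rw [Finset.card_insert_of_notMem (by simp [h3]), Finset.card_erase_add_one h2]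
          exact this.2
      · intro e he e' he' hee
        simp only [Finset.mem_filter] at he he'
        ext k
        have := Finset.ext_iff.1 hee k
        simp only [Finset.mem_insert, Finset.mem_erase] at this
        by_cases h1 : k = s
        · subst h1; simp [he.1.2.2, he'.1.2.2]
        · by_cases h2 : k = 0
          · subst h2; simp [he.1.2.1, he'.1.2.1]
          · simpa [h1, h2] using this
      · intro e he
        simp only [Finset.mem_filter] at he
        rw [Finset.erase_insert]
        simp [he.1.2.2]
      · intro e _; exact hprod _
    · rw [Finset.mul_sum]
      apply sum_le_of_inj _ _ (fun e => insert s (e.erase (s + 1)))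
      · intro e he
        simp only [Finset.mem_filter, not_not] at he ⊢
        obtain ⟨⟨h1, h2, h3⟩, h4⟩ := he
        have := hmem e h1
        refine ⟨hKmem _ ?_ ?_, by simp [h2], by simp⟩
        · intro k hk
          rcases Finset.mem_insert.1 hk with rfl | hk
          · simp
          · obtain ⟨hk1, hk2⟩ := Finset.mem_erase.1 hk
            have h5 := Finset.mem_range.1 (this.1 hk2)
            exact Finset.mem_range.2 (by omega)
        · rw [Finset.card_insert_of_notMem (by simp [h3]), Finset.card_erase_add_one h4]
          exact this.2
      · intro e he e' he' hee
        simp only [Finset.mem_filter, not_not] at he he'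
        ext k
        have := Finset.ext_iff.1 hee k
        simp only [Finset.mem_insert, Finset.mem_erase] at this
        by_cases h1 : k = s
        · subst h1; simp [he.1.2.2, he'.1.2.2]
        · by_cases h2 : k = s + 1
          · subst h2; simp [he.2, he'.2]
          · simpa [h1, h2] using this
      · intro e he
        simp only [Finset.mem_filter, not_not] at he
        obtain ⟨⟨h1, h2, h3⟩, h4⟩ := he
        rw [← Finset.mul_prod_erase (e.erase 0) x (a := s + 1) (by simp [h4])]
        apply le_of_eq
        congr 1
        apply Finset.prod_congr _ (fun _ _ => rfl)
        ext k
        simp only [Finset.mem_insert, Finset.mem_erase]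
        by_cases hk : k = s
        · subst hk; simp [h3]
        · simp [hk]; tauto
      · intro e _
        exact mul_nonneg ha.le (hprod _)
  have hx0 : x 0 ≤ x s + x (s + 1) := by
    have := first_order (s + 2) E x hx hopt s 0 (by omega) (by omega) (by omega) (hpos 0 (by omega))
    have hsym : lkW E s 0 x = lkW E 0 s x := by
      unfold lkW
      apply Finset.sum_congr
      · ext e; simp [and_comm]
      · intro e _; rw [Finset.erase_right_comm]
    rw [hsym] at this
    have h : lkW E 0 s x * (x 0 - x s - x (s + 1)) ≤ 0 := by nlinarith
    by_contra hc
    push Not at hc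
    nlinarith
  -- second
  have hfo := first_order (s + 2) E x hx hopt s (s + 1) (by omega) (by omega) (by omega) ha
  set M := ((Finset.range s).powersetCard (r - 1)).filter (fun A => insert (s + 1) A ∉ E) with hM
  set N := ((Finset.range s).powersetCard (r - 2)).filter
        (fun B => insert s (insert (s + 1) B) ∈ E) with hN
  have hUs : lkU E (s + 1) s x + ∑ A ∈ M, ∏ k ∈ A, x k ≤ lkU E s (s + 1) x := by
    have h1 : ∑ A ∈ (Finset.range s).powersetCard (r - 1), ∏ k ∈ A, x k ≤ lkU E s (s + 1) x := by
      unfold lkU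
      apply sum_le_of_inj _ _ (fun A => insert s A)
      · intro A hA
        obtain ⟨h1, h2⟩ := Finset.mem_powersetCard.1 hA
        have hsA : s ∉ A := fun h => by simpa using h1 h
        have hsA' : s + 1 ∉ A := fun h => by simpa using h1 h
        simp only [Finset.mem_filter]
        refine ⟨hKmem _ ?_ ?_, by simp, by simp [hsA']⟩
        · intro k hk
          rcases Finset.mem_insert.1 hk with rfl | hk
          · simp
          · have := Finset.mem_range.1 (h1 hk)
            exact Finset.mem_range.2 (by omega)
        · rw [Finset.card_insert_of_notMem hsA]; omega
      · intro A hA A' hA' h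
        obtain ⟨h1, h2⟩ := Finset.mem_powersetCard.1 hA
        have hsA : s ∉ A := fun h => by simpa using h1 h
        obtain ⟨h1', h2'⟩ := Finset.mem_powersetCard.1 hA'
        have hsA' : s ∉ A' := fun h => by simpa using h1' h
        rw [← Finset.erase_insert hsA, h, Finset.erase_insert hsA']
      · intro A hA
        obtain ⟨h1, h2⟩ := Finset.mem_powersetCard.1 hA
        have hsA : s ∉ A := fun h => by simpa using h1 h
        rw [Finset.erase_insert hsA]
      · intro e _; exact hprod _
    have h2 : lkU E (s + 1) s x ≤ ∑ A ∈ ((Finset.range s).powersetCard (r - 1)).filter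
        (fun A => insert (s + 1) A ∈ E), ∏ k ∈ A, x k := by
      unfold lkU
      apply sum_le_of_inj _ _ (fun e => e.erase (s + 1))
      · intro e he
        simp only [Finset.mem_filter] at he
        obtain ⟨h1, h2, h3⟩ := he
        have := hmem e h1
        simp only [Finset.mem_filter, Finset.mem_powersetCard]
        refine ⟨⟨?_, ?_⟩, ?_⟩
        · intro k hk
          obtain ⟨hk1, hk2⟩ := Finset.mem_erase.1 hk
          have h5 := Finset.mem_range.1 (this.1 hk2)
          have : k ≠ s := fun h => h3 (h ▸ hk2)
          exact Finset.mem_range.2 (by omega)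
        · rw [Finset.card_erase_of_mem h2, this.2]
        · rw [Finset.insert_erase h2]; exact h1
      · intro e he e' he' h
        simp only [Finset.mem_filter] at he he'
        rw [← Finset.insert_erase he.2.1, h, Finset.insert_erase he'.2.1]
      · intro e _; exact le_refl _
      · intro e _; exact hprod _
    have h3 := Finset.sum_filter_add_sum_filter_not ((Finset.range s).powersetCard (r - 1))
      (fun A => insert (s + 1) A ∈ E) (fun A => ∏ k ∈ A, x k)
    rw [hM]
    linarith
  have hWs : lkW E s (s + 1) x ≤ ∑ B ∈ N, ∏ k ∈ B, x k := by
    unfold lkW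
    apply sum_le_of_inj _ _ (fun e => (e.erase s).erase (s + 1))
    · intro e he
      simp only [Finset.mem_filter] at he
      obtain ⟨h1, h2, h3⟩ := he
      have := hmem e h1
      have h3' : s + 1 ∈ e.erase s := by simp [h3]
      simp only [hN, Finset.mem_filter, Finset.mem_powersetCard]
      refine ⟨⟨?_, ?_⟩, ?_⟩
      · intro k hk
        obtain ⟨hk1, hk2⟩ := Finset.mem_erase.1 hk
        obtain ⟨hk2, hk3⟩ := Finset.mem_erase.1 hk2
        have h5 := Finset.mem_range.1 (this.1 hk3)
        exact Finset.mem_range.2 (by omega)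
      · rw [Finset.card_erase_of_mem h3', Finset.card_erase_of_mem h2, this.2]; omega
      · rw [Finset.insert_erase h3', Finset.insert_erase h2]; exact h1
    · intro e he e' he' h
      simp only [Finset.mem_filter] at he he'
      have h3 : s + 1 ∈ e.erase s := by simp [he.2.2]
      have h3' : s + 1 ∈ e'.erase s := by simp [he'.2.2]
      rw [← Finset.insert_erase he.2.1, ← Finset.insert_erase h3, h, Finset.insert_erase h3',
        Finset.insert_erase he'.2.1]
    · intro e _; exact le_refl _
    · intro e _; exact hprod _
  have hMb : (M.card : ℝ) * x s ^ (r - 1) ≤ ∑ A ∈ M, ∏ k ∈ A, x k := by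
    rw [← nsmul_eq_mul]
    apply Finset.card_nsmul_le_sum
    intro A hA
    obtain ⟨h1, h2⟩ := Finset.mem_powersetCard.1 (Finset.mem_filter.1 hA).1
    rw [← h2, ← Finset.prod_const]
    apply Finset.prod_le_prod
    · intro k _; exact hb.le
    · intro k hk
      exact hanti k s (Finset.mem_range.1 (h1 hk)) (by omega)
  have hNb : ∑ B ∈ N, ∏ k ∈ B, x k ≤ (N.card : ℝ) * (x s + x (s + 1)) ^ (r - 2) := by
    rw [← nsmul_eq_mul]
    apply Finset.sum_le_card_nsmul
    intro B hB
    obtain ⟨h1, h2⟩ := Finset.mem_powersetCard.1 (Finset.mem_filter.1 hB).1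
    rw [← h2, ← Finset.prod_const]
    apply Finset.prod_le_prod
    · intro k _; exact hx.1 k
    · intro k hk
      rcases Nat.eq_zero_or_pos k with rfl | hk0
      · exact hx0
      · have := hanti 0 k hk0 (by have := Finset.mem_range.1 (h1 hk); omega)
        linarith
  have hWnn := lkW_nonneg E s (s + 1) x hx.1
  rcases Nat.eq_zero_or_pos N.card with hN0 | hN0
  · have hW : lkW E s (s + 1) x = 0 := by
      rw [hN0] at hNb
      simp only [Nat.cast_zero, zero_mul] at hNb
      linarith
    have h1 := mv_weighting (s + 2) x hx s (s + 1) (by omega) (by omega) (by omega) (x (s + 1))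
      (by linarith) (by linarith)
    have h2 := lag_mv E s (s + 1) (by omega) x (x (s + 1))
    rw [hW] at h2
    have hMnn : 0 ≤ ∑ A ∈ M, ∏ k ∈ A, x k := Finset.sum_nonneg (fun A _ => hprod A)
    have h4 := hmin _ h1 (by rw [h2]; nlinarith)
    rw [mv_moment (s + 2) x s (s + 1) (by omega) (by omega)] at h4
    push_cast at h4
    linarith
  · obtain ⟨q, rfl⟩ : ∃ q, r = q + 3 := ⟨r - 3, by omega⟩
    have f1 : q + 3 - 3 = q := by omega
    have f2 : q + 3 - 2 = q + 1 := by omega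
    have f3 : q + 3 - 1 = q + 2 := by omega
    rw [f1] at hcond
    rw [f2] at hNb
    rw [f3] at hMb
    have hcondR : (2 : ℝ) ^ q * N.card ≤ M.card := by exact_mod_cast hcond
    have hNR : (0 : ℝ) < N.card := by exact_mod_cast hN0
    generalize (N.card : ℝ) = n at *
    generalize (M.card : ℝ) = m at *
    generalize x s = b at *
    generalize x (s + 1) = a at *
    have g1 : (a + b) ^ q ≤ (2 * b) ^ q := pow_le_pow_left₀ (by linarith) (by linarith) q
    have g2 : m * b ^ (q + 2) ≤ (n * (b + a) ^ (q + 1)) * (b - a) := by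
      have : lkW E s (s + 1) x * (b - a) ≤ (n * (b + a) ^ (q + 1)) * (b - a) :=
        mul_le_mul_of_nonneg_right (by linarith) (by linarith)
      linarith
    have g3 : (n * (b + a) ^ (q + 1)) * (b - a) ≤ n * (2 * b) ^ q * (b ^ 2 - a ^ 2) := by
      have : (n * (b + a) ^ (q + 1)) * (b - a) = n * (a + b) ^ q * (b ^ 2 - a ^ 2) := by ring
      rw [this]
      apply mul_le_mul_of_nonneg_right _ (by nlinarith)
      exact mul_le_mul_of_nonneg_left g1 hNR.le
    have g4 : (2 : ℝ) ^ q * n * b ^ (q + 2) ≤ m * b ^ (q + 2) :=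
      mul_le_mul_of_nonneg_right hcondR (by positivity)
    have g5 : (2 : ℝ) ^ q * n * b ^ (q + 2) = n * (2 * b) ^ q * b ^ 2 := by
      rw [mul_pow]; ring
    have g6 : 0 < n * (2 * b) ^ q * a ^ 2 := by positivity
    nlinarith

theorem lagPoly_last_zero (r t : ℕ) (ht : 0 < t) (E : Finset (Finset ℕ))
    (hE : E ⊆ (Finset.range t).powersetCard r) (x : ℕ → ℝ) (hx : ∀ i, 0 ≤ x i)
    (h0 : x (t - 1) = 0) : lagPoly E x ≤ lagPoly (completeG (t - 1) r) x := by
  have h : lagPoly E x = lagPoly (E.filter (fun e => t - 1 ∉ e)) x := by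
    unfold lagPoly
    symm
    apply Finset.sum_subset (Finset.filter_subset _ _)
    intro e he he'
    simp only [Finset.mem_filter, not_and, not_not] at he'
    exact Finset.prod_eq_zero (he' he) h0
  rw [h]
  apply lagPoly_mono _ _ _ x hx
  intro e he
  simp only [Finset.mem_filter] at he
  obtain ⟨h1, h2⟩ := Finset.mem_powersetCard.1 (hE he.1)
  refine Finset.mem_powersetCard.2 ⟨?_, h2⟩
  intro k hk
  have h3 := Finset.mem_range.1 (h1 hk)
  have : k ≠ t - 1 := fun h => he.2 (h ▸ hk)
  exact Finset.mem_range.2 (by omega)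

theorem drop_last_weighting (t : ℕ) (ht : 0 < t) (x : ℕ → ℝ) (hx : IsWeighting t x)
    (h0 : x (t - 1) = 0) : IsWeighting (t - 1) x := by
  obtain ⟨s, rfl⟩ : ∃ s, t = s + 1 := ⟨t - 1, by omega⟩
  simp only [Nat.add_sub_cancel] at *
  obtain ⟨h1, h2, h3⟩ := hx
  refine ⟨h1, ?_, ?_⟩
  · intro i hi
    rcases Nat.eq_or_lt_of_le hi with h | h
    · rw [← h]; exact h0
    · exact h2 i h
  · rw [Finset.sum_range_succ, h0, add_zero] at h3; exact h3

theorem case_a (r t : ℕ) (hr : 3 ≤ r) (ht : r + 2 ≤ t)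
    (E : Finset (Finset ℕ)) (hE : E ⊆ (Finset.range t).powersetCard r)
    (hlc : LeftCompressed E)
    (hcond : 2 ^ (r - 3) * (((Finset.range (t - 2)).powersetCard (r - 2)).filter
        (fun B => insert (t - 2) (insert (t - 1) B) ∈ E)).card ≤
      (((Finset.range (t - 2)).powersetCard (r - 1)).filter
        (fun A => insert (t - 1) A ∉ E)).card)
    (hK : completeG (t - 1) r ⊆ E) : lag E = lag (completeG (t - 1) r) := by
  obtain ⟨x, hx, hopt, hl, hmin⟩ := exists_opt t r (by omega) E hE
  apply le_antisymm
  · have h0 := last_zero r t hr ht E hE hlc hK hcond x hx (hopt t) hmin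
    rw [hl]
    exact (lagPoly_last_zero r t (by omega) E hE x hx.1 h0).trans
      (le_lag (t - 1) r (by omega) _ (Finset.Subset.refl _) t x hx)
  · obtain ⟨y, hy, _, hl', _⟩ := exists_opt (t - 1) r (by omega) (completeG (t - 1) r)
      (Finset.Subset.refl _)
    rw [hl']
    exact (lagPoly_mono _ _ hK y hy.1).trans (le_lag t r (by omega) E hE _ y hy)

theorem lag_complete_pos (m r : ℕ) (hm : 0 < m) (hrm : r ≤ m) : 0 < lag (completeG m r) := by
  have hw : IsWeighting m (fun k => if k < m then 1 / (m : ℝ) else 0) := by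
    refine ⟨?_, ?_, ?_⟩
    · intro k; dsimp only; split_ifs <;> positivity
    · intro k hk; simp [not_lt.2 hk]
    · rw [Finset.sum_congr rfl (g := fun _ => 1 / (m : ℝ))
        (fun k hk => if_pos (Finset.mem_range.1 hk))]
      have : (m : ℝ) ≠ 0 := by positivity
      simp [this]
  refine lt_of_lt_of_le ?_ (le_lag m r hm _ (Finset.Subset.refl _) m _ hw)
  unfold lagPoly
  apply Finset.sum_pos
  · intro e he
    apply Finset.prod_pos
    intro k hk
    have := Finset.mem_range.1 ((Finset.mem_powersetCard.1 he).1 hk)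
    rw [if_pos this]
    positivity
  · exact Finset.powersetCard_nonempty.2 (by simpa using hrm)

/-- An optimal weighting of a complete graph has no zero vertex. -/
theorem complete_opt_pos (m r : ℕ) (hr : 3 ≤ r) (hrm : r ≤ m) (x : ℕ → ℝ) (hx : IsWeighting m x)
    (hl : lag (completeG m r) ≤ lagPoly (completeG m r) x) (v : ℕ) (hv : v < m) : x v ≠ 0 := by
  intro h0
  have hpos := lt_of_lt_of_le (lag_complete_pos m r (by omega) hrm) hl
  have hopt : ∀ w, IsWeighting m w → lagPoly (completeG m r) w ≤ lagPoly (completeG m r) x :=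
    fun w hw => (le_lag m r (by omega) _ (Finset.Subset.refl _) m w hw).trans hl
  obtain ⟨e, he, hep⟩ : ∃ e ∈ completeG m r, 0 < ∏ k ∈ e, x k := by
    by_contra hcon
    push Not at hcon
    have : lagPoly (completeG m r) x ≤ 0 := Finset.sum_nonpos hcon
    linarith
  obtain ⟨h1, h2⟩ := Finset.mem_powersetCard.1 he
  have hep' : ∀ k ∈ e, 0 < x k := by
    intro k hk
    refine lt_of_le_of_ne (hx.1 k) (fun h => ?_)
    rw [Finset.prod_eq_zero hk h.symm] at hep
    exact lt_irrefl _ hep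
  have hve : v ∉ e := fun h => by have := hep' v h; linarith
  obtain ⟨j, hj, k, hk, hjk⟩ := Finset.one_lt_card.1 (by omega : 1 < e.card)
  have hjv : v ≠ j := fun h => hve (h ▸ hj)
  have hjm := Finset.mem_range.1 (h1 hj)
  have hfo := first_order m _ x hx hopt v j hjv hv hjm (hep' j hj)
  have hU : lkU (completeG m r) j v x ≤ lkU (completeG m r) v j x := by
    apply lkU_le _ _ _ hjv _ hx.1
    intro e he hje hve
    obtain ⟨h1, h2⟩ := Finset.mem_powersetCard.1 he
    refine Finset.mem_powersetCard.2 ⟨?_, ?_⟩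
    · intro k hk
      rcases Finset.mem_insert.1 hk with rfl | hk
      · exact Finset.mem_range.2 hv
      · exact h1 (Finset.mem_of_mem_erase hk)
    · rw [Finset.card_insert_of_notMem (by simp [hve]), Finset.card_erase_add_one hje]
      exact h2
  have hW : 0 < lkW (completeG m r) v j x := by
    unfold lkW
    apply Finset.sum_pos'
    · intro e _; exact Finset.prod_nonneg (fun i _ => hx.1 i)
    · refine ⟨insert v (e.erase k), ?_, ?_⟩
      · simp only [Finset.mem_filter]
        refine ⟨Finset.mem_powersetCard.2 ⟨?_, ?_⟩, by simp, by simp [hj, hjk]⟩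
        · intro l hl
          rcases Finset.mem_insert.1 hl with rfl | hl
          · exact Finset.mem_range.2 hv
          · exact h1 (Finset.mem_of_mem_erase hl)
        · rw [Finset.card_insert_of_notMem (by simp [hve]), Finset.card_erase_add_one hk]
          exact h2
      · apply Finset.prod_pos
        intro l hl
        simp only [Finset.mem_erase, Finset.mem_insert] at hl
        exact hep' l (by tauto)
  have := hep' j hj
  rw [h0] at hfo
  nlinarith

/-- For a left-compressed r-graph on t vertices with
|[t-2]^{(r-1)} \ E_t| ≥ 2^{r-3}|E_{(t-1)t}|: (a) if G contains [t-1]^{(r)} then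
λ(G) = λ([t-1]^{(r)}); (b) otherwise λ(G) < λ([t-1]^{(r)}). (Vertices 0,…,t-1.) -/
theorem stmt_14 (r t : ℕ) (hr : 3 ≤ r) (ht : r + 2 ≤ t)
    (E : Finset (Finset ℕ)) (hE : E ⊆ (Finset.range t).powersetCard r)
    (hlc : LeftCompressed E)
    (hcond : 2 ^ (r - 3) * (((Finset.range (t - 2)).powersetCard (r - 2)).filter
        (fun B => insert (t - 2) (insert (t - 1) B) ∈ E)).card ≤
      (((Finset.range (t - 2)).powersetCard (r - 1)).filter
        (fun A => insert (t - 1) A ∉ E)).card) :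
    (completeG (t - 1) r ⊆ E → lag E = lag (completeG (t - 1) r)) ∧
    (¬ completeG (t - 1) r ⊆ E → lag E < lag (completeG (t - 1) r)) := by
  refine ⟨case_a r t hr ht E hE hlc hcond, ?_⟩
  intro hnot
  have hKt : completeG (t - 1) r ⊆ (Finset.range t).powersetCard r :=
    Finset.powersetCard_mono (Finset.range_mono (by omega))
  have hE' : E ∪ completeG (t - 1) r ⊆ (Finset.range t).powersetCard r :=
    Finset.union_subset hE hKt
  have hiff : ∀ e : Finset ℕ, t - 1 ∈ e → (e ∈ E ∪ completeG (t - 1) r ↔ e ∈ E) := by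
    intro e he
    rw [Finset.mem_union]
    refine ⟨fun h => h.elim id (fun h => ?_), Or.inl⟩
    have := (Finset.mem_powersetCard.1 h).1 he
    simp at this
  have hcond' : 2 ^ (r - 3) * (((Finset.range (t - 2)).powersetCard (r - 2)).filter
        (fun B => insert (t - 2) (insert (t - 1) B) ∈ E ∪ completeG (t - 1) r)).card ≤
      (((Finset.range (t - 2)).powersetCard (r - 1)).filter
        (fun A => insert (t - 1) A ∉ E ∪ completeG (t - 1) r)).card := by
    have h1 : ∀ B : Finset ℕ, (insert (t - 2) (insert (t - 1) B) ∈ E ∪ completeG (t - 1) r) ↔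
        insert (t - 2) (insert (t - 1) B) ∈ E := fun B => hiff _ (by simp)
    have h2 : ∀ A : Finset ℕ, (insert (t - 1) A ∉ E ∪ completeG (t - 1) r) ↔
        insert (t - 1) A ∉ E := fun A => not_congr (hiff _ (by simp))
    simp only [h1, h2]
    exact hcond
  have ha := case_a r t hr ht _ hE' (lc_union E hlc _ _) hcond' Finset.subset_union_right
  obtain ⟨x, hx, hopt, hl, hmin⟩ := exists_opt t r (by omega) E hE
  by_contra hcon
  push Not at hcon
  obtain ⟨e, heK, heE⟩ := Finset.not_subset.1 hnot
  obtain ⟨h1, h2⟩ := Finset.mem_powersetCard.1 heK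
  have hsub : insert e E ⊆ E ∪ completeG (t - 1) r := by
    intro f hf
    rcases Finset.mem_insert.1 hf with rfl | hf
    · exact Finset.mem_union_right _ heK
    · exact Finset.mem_union_left _ hf
  have h3 := lagPoly_mono _ _ hsub x hx.1
  have h4 : lagPoly (insert e E) x = ∏ k ∈ e, x k + lagPoly E x := Finset.sum_insert heE
  have h5 := le_lag t r (by omega) _ hE' t x hx
  have h6 : ∏ k ∈ e, x k = 0 :=
    le_antisymm (by linarith) (Finset.prod_nonneg (fun i _ => hx.1 i))
  obtain ⟨v, hve, hv0⟩ := Finset.prod_eq_zero_iff.1 h6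
  have hvt := Finset.mem_range.1 (h1 hve)
  have hlast : x (t - 1) = 0 := by
    apply le_antisymm _ (hx.1 _)
    rw [← hv0]
    exact opt_antitone t E hlc x hx hmin v (t - 1) hvt (by omega)
  have hx' := drop_last_weighting t (by omega) x hx hlast
  have h7 := lagPoly_last_zero r t (by omega) E hE x hx.1 hlast
  exact complete_opt_pos (t - 1) r hr (by omega) x hx' (by linarith) v hvt hv0
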